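/- arXiv:1209.3998 — 8 statements merged into one kernel-verified Lean document; each statement's English description precedes it below -/
import Mathlib

section
/- Let r : ℝ → ℝ be four times differentiable with r(x) > 0 for all x. Then for every x ∈ ℝ, G(r)(x) = −[ r''''(x)/(1+r'(x)^2)^2 + (2r'(x)(1+r'(x)^2−5r(x)r''(x))/(r(x)(1+r'(x)^2)^3))·r'''(x) ] + (r'(x)^2−1)/(r(x)^2(1+r'(x)^2)^2)·r''(x) + (6r'(x)^2−1)/(r(x)(1+r'(x)^2)^3)·r''(x)^2 + (3−15r'(x)^2)/(1+r'(x)^2)^4·r''(x)^3 + r'(x)^2/(r(x)^3(1+r'(x)^2)). (The axisymmetric surface diffusion operator is quasilinear of fourth order with this explicit expansion.) -/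
open Real

/-- The (normalized) mean curvature of the surface of revolution with profile `r`. -/
noncomputable def meanCurv (r : ℝ → ℝ) (x : ℝ) : ℝ :=
  1 / (r x * Real.sqrt (1 + (deriv r x) ^ 2)) -
    deriv (deriv r) x / (1 + (deriv r x) ^ 2) ^ ((3 : ℝ) / 2)

/-- The axisymmetric surface diffusion operator
`G(r)(x) = (1/r) ∂ₓ [ (r/√(1+r'²)) ∂ₓ H(r) ](x)`. -/
noncomputable def asdG (r : ℝ → ℝ) (x : ℝ) : ℝ :=
  (1 / r x) *
    deriv (fun y => r y / Real.sqrt (1 + (deriv r y) ^ 2) * deriv (meanCurv r) y) x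

lemma hasDerivAt_one_add_sq {p : ℝ → ℝ} {q x : ℝ} (hp : HasDerivAt p q x) :
    HasDerivAt (fun y => 1 + p y ^ 2) (2 * p x * q) x := by
  simpa using (hp.pow 2).const_add 1

lemma meanCurv_eq_sqrt (r : ℝ → ℝ) :
    meanCurv r = fun y => 1 / (r y * √(1 + deriv r y ^ 2)) -
      deriv (deriv r) y / √(1 + deriv r y ^ 2) ^ 3 := by
  funext y
  have hpow : (1 + deriv r y ^ 2) ^ ((3 : ℝ) / 2) = √(1 + deriv r y ^ 2) ^ 3 := by
    rw [sqrt_eq_rpow, ← rpow_mul_natCast (by positivity)]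
    norm_num
  rw [meanCurv, hpow]

lemma hasDerivAt_meanCurv {r : ℝ → ℝ} {y : ℝ}
    (h1 : DifferentiableAt ℝ r y) (h2 : DifferentiableAt ℝ (deriv r) y)
    (h3 : DifferentiableAt ℝ (deriv (deriv r)) y) (hr : r y ≠ 0) :
    HasDerivAt (meanCurv r)
      (-deriv r y / (r y ^ 2 * √(1 + deriv r y ^ 2)) -
          deriv r y * deriv (deriv r) y / (r y * √(1 + deriv r y ^ 2) ^ 3) -
          deriv (deriv (deriv r)) y / √(1 + deriv r y ^ 2) ^ 3 +
          3 * deriv r y * deriv (deriv r) y ^ 2 / √(1 + deriv r y ^ 2) ^ 5) y := by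
  have hw : 0 < 1 + deriv r y ^ 2 := by positivity
  have hs : √(1 + deriv r y ^ 2) ≠ 0 := (sqrt_pos.2 hw).ne'
  have hsqrt := (hasDerivAt_one_add_sq h2.hasDerivAt).sqrt hw.ne'
  rw [meanCurv_eq_sqrt]
  refine (((hasDerivAt_const y (1 : ℝ)).fun_div (h1.hasDerivAt.fun_mul hsqrt)
    (mul_ne_zero hr hs)).fun_sub (h3.hasDerivAt.fun_div (hsqrt.fun_pow 3) (pow_ne_zero 3 hs))).congr_deriv ?_
  generalize √(1 + deriv r y ^ 2) = s at hs ⊢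
  push_cast
  field_simp
  ring

/-- The flux `(r/√(1+r'²)) ∂ₓ H(r)` as a rational function of `r` and its derivatives. -/
lemma flux_eq {r : ℝ → ℝ} {y : ℝ}
    (h1 : DifferentiableAt ℝ r y) (h2 : DifferentiableAt ℝ (deriv r) y)
    (h3 : DifferentiableAt ℝ (deriv (deriv r)) y) (hr : r y ≠ 0) :
    r y / √(1 + deriv r y ^ 2) * deriv (meanCurv r) y =
      -deriv r y / (r y * (1 + deriv r y ^ 2)) -
        (deriv r y * deriv (deriv r) y + r y * deriv (deriv (deriv r)) y) /
          (1 + deriv r y ^ 2) ^ 2 +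
        3 * (r y * deriv r y * deriv (deriv r) y ^ 2) / (1 + deriv r y ^ 2) ^ 3 := by
  have hw : 0 < 1 + deriv r y ^ 2 := by positivity
  have hs : √(1 + deriv r y ^ 2) ≠ 0 := (sqrt_pos.2 hw).ne'
  have hsq := sq_sqrt hw.le
  rw [(hasDerivAt_meanCurv h1 h2 h3 hr).deriv]
  generalize √(1 + deriv r y ^ 2) = s at hs hsq ⊢
  rw [← hsq]
  field_simp
  ring

/-- The axisymmetric surface diffusion operator is quasilinear of fourth order, with the
explicit expansion `G(r) = -𝒜(r)r + f(r)`. -/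
theorem asdG_quasilinear_expansion (r : ℝ → ℝ)
    (h1 : Differentiable ℝ r)
    (h2 : Differentiable ℝ (deriv r))
    (h3 : Differentiable ℝ (deriv (deriv r)))
    (h4 : Differentiable ℝ (deriv (deriv (deriv r))))
    (hpos : ∀ x, 0 < r x) :
    ∀ x : ℝ,
      asdG r x =
        -(deriv (deriv (deriv (deriv r))) x / (1 + (deriv r x) ^ 2) ^ 2 +
            2 * deriv r x * (1 + (deriv r x) ^ 2 - 5 * r x * deriv (deriv r) x) /
                (r x * (1 + (deriv r x) ^ 2) ^ 3) *
              deriv (deriv (deriv r)) x) +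
          ((deriv r x) ^ 2 - 1) / (r x ^ 2 * (1 + (deriv r x) ^ 2) ^ 2) * deriv (deriv r) x +
          (6 * (deriv r x) ^ 2 - 1) / (r x * (1 + (deriv r x) ^ 2) ^ 3) *
            (deriv (deriv r) x) ^ 2 +
          (3 - 15 * (deriv r x) ^ 2) / (1 + (deriv r x) ^ 2) ^ 4 * (deriv (deriv r) x) ^ 3 +
          (deriv r x) ^ 2 / (r x ^ 3 * (1 + (deriv r x) ^ 2)) := by
  intro x
  have hr : r x ≠ 0 := (hpos x).ne'
  have hw : 1 + deriv r x ^ 2 ≠ 0 := by positivity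
  have d1 := (h1 x).hasDerivAt
  have d2 := (h2 x).hasDerivAt
  have d3 := (h3 x).hasDerivAt
  have d4 := (h4 x).hasDerivAt
  have dw := hasDerivAt_one_add_sq d2
  have hflux := ((d2.fun_neg.fun_div (d1.fun_mul dw) (mul_ne_zero hr hw)).fun_sub
    (((d2.fun_mul d3).fun_add (d1.fun_mul d4)).fun_div (dw.fun_pow 2) (pow_ne_zero 2 hw))).fun_add
    ((((d1.fun_mul d2).fun_mul (d3.fun_pow 2)).const_mul 3).fun_div (dw.fun_pow 3)
      (pow_ne_zero 3 hw))
  rw [asdG, funext fun y => flux_eq (h1 y) (h2 y) (h3 y) (hpos y).ne', hflux.deriv]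
  push_cast
  field_simp
  ring
end

section
/- Let r be a classical solution of the axisymmetric surface diffusion flow on an open interval I. Then the enclosed volume is preserved: the function t ↦ ∫_{−π}^{π} r(t,x)^2 dx is constant on I. -/
open Real

open MeasureTheory Set Filter Topology
open scoped ContDiff

/-- Differentiation under the integral sign for a `C¹` integrand on an open strip. -/
theorem hasDerivAt_intervalIntegral_of_contDiffOn {u : ℝ → ℝ → ℝ} {s : Set ℝ} (hs : IsOpen s)
    (hu : ContDiffOn ℝ 1 (fun p : ℝ × ℝ => u p.1 p.2) (s ×ˢ univ)) (c d : ℝ) {t : ℝ}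
    (ht : t ∈ s) :
    HasDerivAt (fun τ => ∫ x in c..d, u τ x) (∫ x in c..d, deriv (fun τ => u τ x) t) t := by
  have hopen : IsOpen (s ×ˢ (univ : Set ℝ)) := hs.prod isOpen_univ
  have hderiv : ∀ τ ∈ s, ∀ x, HasDerivAt (fun σ => u σ x)
      (fderiv ℝ (fun p : ℝ × ℝ => u p.1 p.2) (τ, x) (1, 0)) τ := by
    intro τ hτ x
    have h := ((hu.differentiableOn one_ne_zero).differentiableAt
      (hopen.mem_nhds (show (τ, x) ∈ s ×ˢ univ from ⟨hτ, trivial⟩))).hasFDerivAt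
    exact h.comp_hasDerivAt τ ((hasDerivAt_id τ).prodMk (hasDerivAt_const τ x))
  have hcont : ContinuousOn (fun p : ℝ × ℝ => fderiv ℝ (fun p : ℝ × ℝ => u p.1 p.2) p (1, 0))
      (s ×ˢ univ) :=
    (hu.continuousOn_fderiv_of_isOpen hopen le_rfl).clm_apply continuousOn_const
  have hslice : ∀ (f : ℝ × ℝ → ℝ), ContinuousOn f (s ×ˢ univ) → ∀ τ ∈ s,
      Continuous fun x => f (τ, x) := fun f hf τ hτ =>
    hf.comp_continuous (by fun_prop) fun x => ⟨hτ, trivial⟩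
  obtain ⟨ε, hε, hball⟩ := Metric.nhds_basis_closedBall.mem_iff.1 (hs.mem_nhds ht)
  obtain ⟨C, hC⟩ := ((isCompact_closedBall t ε).prod (isCompact_uIcc (a := c) (b := d))
    ).exists_bound_of_continuousOn (hcont.mono (prod_mono hball (subset_univ _)))
  have key := (intervalIntegral.hasDerivAt_integral_of_dominated_loc_of_deriv_le (μ := volume)
    (F := u) (F' := fun τ x => fderiv ℝ (fun p : ℝ × ℝ => u p.1 p.2) (τ, x) (1, 0))
    (a := c) (b := d) (bound := fun _ => C) (Metric.closedBall_mem_nhds t hε)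
    (by
      filter_upwards [hs.mem_nhds ht] with τ hτ
      exact (hslice _ hu.continuousOn τ hτ).aestronglyMeasurable)
    ((hslice _ hu.continuousOn t ht).intervalIntegrable _ _)
    (hslice _ hcont t ht).aestronglyMeasurable
    (ae_of_all _ fun x hx τ hτ => hC (τ, x) ⟨hτ, uIoc_subset_uIcc hx⟩)
    intervalIntegrable_const
    (ae_of_all _ fun x _ τ hτ => hderiv τ (hball hτ) x)).2
  simpa only [(hderiv t ht _).deriv] using key

theorem Function.Periodic.deriv_periodic {f : ℝ → ℝ} {c : ℝ} (hf : Function.Periodic f c) :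
    Function.Periodic (deriv f) c := fun x => by
  rw [← deriv_comp_add_const, hf.funext]

theorem contDiff_meanCurv {r : ℝ → ℝ} (hr : ContDiff ℝ ∞ r) (hpos : ∀ x, 0 < r x) :
    ContDiff ℝ ∞ (meanCurv r) := by
  have h1 : ContDiff ℝ ∞ (deriv r) := (contDiff_infty_iff_deriv.1 hr).2
  have h2 : ContDiff ℝ ∞ (deriv (deriv r)) := (contDiff_infty_iff_deriv.1 h1).2
  have hq : ContDiff ℝ ∞ fun x => 1 + deriv r x ^ 2 := contDiff_const.add (h1.pow 2)
  have hq0 : ∀ x, 0 < 1 + deriv r x ^ 2 := fun x => by positivity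
  exact (contDiff_const.div (hr.mul (hq.sqrt fun x => (hq0 x).ne'))
    fun x => (mul_pos (hpos x) (sqrt_pos.2 (hq0 x))).ne').sub
    (h2.div (hq.rpow_const_of_ne fun x => (hq0 x).ne') fun x => (rpow_pos_of_pos (hq0 x) _).ne')

theorem Function.Periodic.meanCurv {r : ℝ → ℝ} {c : ℝ} (hr : Function.Periodic r c) :
    Function.Periodic (meanCurv r) c := fun x => by
  simp only [_root_.meanCurv, hr x, hr.deriv_periodic x, hr.deriv_periodic.deriv_periodic x]

theorem mul_asdG {r : ℝ → ℝ} {x : ℝ} (hx : r x ≠ 0) :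
    r x * asdG r x =
      deriv (fun y => r y / √(1 + deriv r y ^ 2) * deriv (meanCurv r) y) x := by
  rw [asdG, ← mul_assoc, mul_one_div_cancel hx, one_mul]

/-- Surface diffusion is in divergence form, so `r * G(r)` has zero mean over a period. -/
theorem integral_mul_asdG_eq_zero {r : ℝ → ℝ} (hr : ContDiff ℝ ∞ r) (hpos : ∀ x, 0 < r x)
    (hper : Function.Periodic r (2 * π)) : ∫ x in (-π)..π, r x * asdG r x = 0 := by
  have h1 : ContDiff ℝ ∞ (deriv r) := (contDiff_infty_iff_deriv.1 hr).2
  have hq : ContDiff ℝ ∞ fun x => 1 + deriv r x ^ 2 := contDiff_const.add (h1.pow 2)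
  have hq0 : ∀ x, 0 < 1 + deriv r x ^ 2 := fun x => by positivity
  have hflux : ContDiff ℝ ∞ fun y => r y / √(1 + deriv r y ^ 2) * deriv (meanCurv r) y :=
    (hr.div (hq.sqrt fun x => (hq0 x).ne') fun x => (sqrt_pos.2 (hq0 x)).ne').mul
      (contDiff_infty_iff_deriv.1 (contDiff_meanCurv hr hpos)).2
  have hflux' := contDiff_infty_iff_deriv.1 hflux
  simp only [mul_asdG (hpos _).ne']
  rw [intervalIntegral.integral_deriv_eq_sub (fun x _ => hflux'.1 x)
    (hflux'.2.continuous.intervalIntegrable _ _), sub_eq_zero,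
    show π = -π + 2 * π by ring]
  have hπ : -(-π + 2 * π) = -π := by ring
  simp only [hπ, hper (-π), hper.deriv_periodic (-π), hper.meanCurv.deriv_periodic (-π)]

/-- Along a classical solution of the axisymmetric surface diffusion flow on an open
interval `(a, b)`, the enclosed volume `∫_{-π}^{π} r(t,x)² dx` is constant. -/
theorem asd_volume_preserved (a b : ℝ) (r : ℝ → ℝ → ℝ)
    (hr : ContDiffOn ℝ (⊤ : ℕ∞) (fun p : ℝ × ℝ => r p.1 p.2) (Set.Ioo a b ×ˢ Set.univ))
    (hpos : ∀ t ∈ Set.Ioo a b, ∀ x : ℝ, 0 < r t x)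
    (hper : ∀ t ∈ Set.Ioo a b, ∀ x : ℝ, r t (x + 2 * Real.pi) = r t x)
    (hflow : ∀ t ∈ Set.Ioo a b, ∀ x : ℝ, deriv (fun s => r s x) t = asdG (r t) x) :
    ∀ t₁ ∈ Set.Ioo a b, ∀ t₂ ∈ Set.Ioo a b,
      (∫ x in (-Real.pi)..Real.pi, (r t₁ x) ^ 2) =
        ∫ x in (-Real.pi)..Real.pi, (r t₂ x) ^ 2 := by
  have hslice : ∀ t ∈ Ioo a b, ContDiff ℝ ∞ (r t) := fun t ht =>
    contDiffOn_univ.1 <| hr.comp (contDiff_prodMk_right t).contDiffOn fun x _ => ⟨ht, trivial⟩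
  have htime : ∀ t ∈ Ioo a b, ∀ x, DifferentiableAt ℝ (fun s => r s x) t := fun t ht x =>
    DifferentiableAt.comp t (f := fun s => (s, x)) (g := fun p : ℝ × ℝ => r p.1 p.2)
      ((hr.differentiableOn (by simp)).differentiableAt
        ((isOpen_Ioo.prod isOpen_univ).mem_nhds ⟨ht, trivial⟩)) (by fun_prop)
  have hvol : ∀ t ∈ Ioo a b, HasDerivAt (fun τ => ∫ x in (-π)..π, r τ x ^ 2) 0 t := by
    intro t ht
    have h := hasDerivAt_intervalIntegral_of_contDiffOn (u := fun τ x => r τ x ^ 2) isOpen_Ioo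
      ((hr.pow 2).of_le (by exact_mod_cast le_top)) (-π) π ht
    have hsq : ∀ x, deriv (fun τ => r τ x ^ 2) t = 2 * (r t x * asdG (r t) x) := fun x => by
      rw [((htime t ht x).hasDerivAt.fun_pow 2).deriv, hflow t ht x]
      ring
    simpa only [hsq, intervalIntegral.integral_const_mul,
      integral_mul_asdG_eq_zero (hslice t ht) (hpos t ht) (hper t ht), mul_zero] using h
  intro t₁ ht₁ t₂ ht₂
  exact isOpen_Ioo.is_const_of_deriv_eq_zero isPreconnected_Ioo
    (fun t ht => (hvol t ht).differentiableAt.differentiableWithinAt)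
    (fun t ht => (hvol t ht).deriv) ht₁ ht₂
end

section
/- Let I ⊆ ℝ be an interval, let r : I → ℝ be twice differentiable with r(x) > 0 on I, and suppose there is a constant c ∈ ℝ such that H(r)(x) = c for all x ∈ I. Then the function x ↦ r(x)/√(1+r'(x)^2) − c·r(x)^2/2 is constant on I (the Delaunay first integral of the constant mean curvature equation for profile curves). -/
open Real

/-- The derivative of `r / √(1 + r'²) - c r² / 2` is `r r' (H(r) - c)`. -/
theorem hasDerivAt_delaunay {r : ℝ → ℝ} {x : ℝ} (c : ℝ)
    (h1 : DifferentiableAt ℝ r x) (h2 : DifferentiableAt ℝ (deriv r) x) (hr : r x ≠ 0) :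
    HasDerivAt (fun y => r y / Real.sqrt (1 + (deriv r y) ^ 2) - c * r y ^ 2 / 2)
      (r x * deriv r x * (meanCurv r x - c)) x := by
  have hq : 0 < 1 + deriv r x ^ 2 := by positivity
  have hs : 0 < Real.sqrt (1 + deriv r x ^ 2) := Real.sqrt_pos.2 hq
  have hpow : (1 + deriv r x ^ 2) ^ ((3 : ℝ) / 2) = Real.sqrt (1 + deriv r x ^ 2) ^ 3 := by
    rw [Real.sqrt_eq_rpow, ← Real.rpow_mul_natCast hq.le]
    norm_num
  have hd := ((h1.hasDerivAt.div (((h2.hasDerivAt.pow 2).const_add 1).sqrt hq.ne') hs.ne').sub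
    (((h1.hasDerivAt.pow 2).const_mul c).div_const 2))
  refine hd.congr_deriv ?_
  simp only [meanCurv, hpow, Pi.pow_apply]
  generalize Real.sqrt (1 + deriv r x ^ 2) = s at hs ⊢
  field_simp
  ring

/-- Delaunay first integral: if a twice differentiable positive profile `r` has constant
mean curvature `c` on an interval `I`, then `r/√(1+r'²) - c r²/2` is constant on `I`. -/
theorem delaunay_first_integral (I : Set ℝ) (hI : I.OrdConnected) (r : ℝ → ℝ) (c : ℝ)
    (h1 : ∀ x ∈ I, DifferentiableAt ℝ r x)
    (h2 : ∀ x ∈ I, DifferentiableAt ℝ (deriv r) x)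
    (hpos : ∀ x ∈ I, 0 < r x)
    (hcmc : ∀ x ∈ I, meanCurv r x = c) :
    ∀ x ∈ I, ∀ y ∈ I,
      r x / Real.sqrt (1 + (deriv r x) ^ 2) - c * r x ^ 2 / 2 =
        r y / Real.sqrt (1 + (deriv r y) ^ 2) - c * r y ^ 2 / 2 := by
  intro x hx y hy
  have hd : ∀ z ∈ I, HasDerivWithinAt
      (fun y => r y / Real.sqrt (1 + (deriv r y) ^ 2) - c * r y ^ 2 / 2) 0 I z := by
    intro z hz
    have h := hasDerivAt_delaunay c (h1 z hz) (h2 z hz) (hpos z hz).ne'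
    rw [hcmc z hz, sub_self, mul_zero] at h
    exact h.hasDerivWithinAt
  have h := hI.convex.norm_image_sub_le_of_norm_hasDerivWithin_le (C := 0) hd
    (fun _ _ => norm_zero.le) hy hx
  rw [zero_mul] at h
  exact sub_eq_zero.1 (norm_le_zero_iff.1 h)
end

section
/- Let H > 0 and B ∈ (−1,1), and write x = x_{H,B}, y = y_{H,B} for the Kenmotsu profile functions. Then the surface of revolution generated by this unit-speed profile curve has constant mean curvature H: for all s ∈ ℝ, x'(s)/y(s) + x''(s)·y'(s) − x'(s)·y''(s) = H, where x'(s)/y(s) and x''(s)y'(s) − x'(s)y''(s) are the azimuthal and axial principal curvatures. -/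
open Real

/-- The second (radial) component of the Kenmotsu profile curve. -/
noncomputable def kenY (H B s : ℝ) : ℝ :=
  Real.sqrt (1 + B ^ 2 + 2 * B * Real.sin (H * s)) / H

/-- The first (axial) component of the Kenmotsu profile curve. -/
noncomputable def kenX (H B s : ℝ) : ℝ :=
  ∫ t in (Real.pi / (2 * H))..s,
    (1 + B * Real.sin (H * t)) / Real.sqrt (1 + B ^ 2 + 2 * B * Real.sin (H * t))

lemma kenmotsu_radicand_pos {B : ℝ} (hB : B ∈ Set.Ioo (-1 : ℝ) 1) (θ : ℝ) :
    0 < 1 + B ^ 2 + 2 * B * Real.sin θ := by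
  nlinarith [sq_nonneg (B + Real.sin θ), Real.sin_sq_le_one θ,
    mul_pos (sub_pos.2 hB.1) (sub_pos.2 hB.2), Real.neg_one_le_sin θ, Real.sin_le_one θ]

lemma hasDerivAt_sin_const_mul (H s : ℝ) :
    HasDerivAt (fun t => Real.sin (H * t)) (H * Real.cos (H * s)) s := by
  simpa [mul_comm] using ((hasDerivAt_id s).const_mul H).sin

lemma hasDerivAt_cos_const_mul (H s : ℝ) :
    HasDerivAt (fun t => Real.cos (H * t)) (-(H * Real.sin (H * s))) s := by
  simpa [mul_comm] using ((hasDerivAt_id s).const_mul H).cos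

lemma hasDerivAt_sqrt_kenmotsu_radicand {B : ℝ} (hB : B ∈ Set.Ioo (-1 : ℝ) 1) (H s : ℝ) :
    HasDerivAt (fun t => √(1 + B ^ 2 + 2 * B * Real.sin (H * t)))
      (B * H * Real.cos (H * s) / √(1 + B ^ 2 + 2 * B * Real.sin (H * s))) s := by
  convert (((hasDerivAt_sin_const_mul H s).const_mul (2 * B)).const_add (1 + B ^ 2)).sqrt
    (kenmotsu_radicand_pos hB (H * s)).ne' using 1
  rw [← mul_div_mul_left _ _ (two_ne_zero (α := ℝ))]
  ring

lemma deriv_kenX {B : ℝ} (hB : B ∈ Set.Ioo (-1 : ℝ) 1) (H : ℝ) :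
    deriv (kenX H B) = fun t =>
      (1 + B * Real.sin (H * t)) / √(1 + B ^ 2 + 2 * B * Real.sin (H * t)) := by
  have hc : Continuous fun t : ℝ =>
      (1 + B * Real.sin (H * t)) / √(1 + B ^ 2 + 2 * B * Real.sin (H * t)) :=
    Continuous.div (by fun_prop) (by fun_prop)
      fun t => (Real.sqrt_pos.2 (kenmotsu_radicand_pos hB (H * t))).ne'
  funext s
  exact hc.deriv_integral _ _ s

lemma deriv_kenY {B : ℝ} (hB : B ∈ Set.Ioo (-1 : ℝ) 1) {H : ℝ} (hH : H ≠ 0) :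
    deriv (kenY H B) = fun t =>
      B * Real.cos (H * t) / √(1 + B ^ 2 + 2 * B * Real.sin (H * t)) := by
  funext s
  have hw := (Real.sqrt_pos.2 (kenmotsu_radicand_pos hB (H * s))).ne'
  refine ((hasDerivAt_sqrt_kenmotsu_radicand hB H s).div_const H).deriv.trans ?_
  field_simp

/-- The surface of revolution generated by the unit-speed Kenmotsu profile curve has
constant mean curvature `H`: the sum of the azimuthal principal curvature `x'/y` and
the axial principal curvature `x''y' - x'y''` equals `H`. -/
theorem kenmotsu_cmc (H B : ℝ) (hH : 0 < H) (hB : B ∈ Set.Ioo (-1 : ℝ) 1) :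
    ∀ s : ℝ,
      deriv (kenX H B) s / kenY H B s +
        (deriv (deriv (kenX H B)) s * deriv (kenY H B) s -
          deriv (kenX H B) s * deriv (deriv (kenY H B)) s) = H := by
  intro s
  have hQ := kenmotsu_radicand_pos hB (H * s)
  have hw := (Real.sqrt_pos.2 hQ).ne'
  have hW := hasDerivAt_sqrt_kenmotsu_radicand hB H s
  have hX := (((hasDerivAt_sin_const_mul H s).const_mul B).const_add 1).fun_div hW hw
  have hY := ((hasDerivAt_cos_const_mul H s).const_mul B).fun_div hW hw
  rw [deriv_kenX hB, deriv_kenY hB hH.ne', hX.deriv, hY.deriv, kenY]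
  beta_reduce
  have hsq := Real.sq_sqrt hQ.le
  have hcs := Real.sin_sq_add_cos_sq (H * s)
  generalize √(1 + B ^ 2 + 2 * B * Real.sin (H * s)) = w at *
  generalize Real.sin (H * s) = a at *
  generalize Real.cos (H * s) = c at *
  field_simp
  linear_combination -w ^ 2 * hsq + B ^ 2 * w ^ 2 * hcs
end

section
/- Let k ≥ 1 be a natural number, let B ∈ (−1,1), and suppose H > 0 satisfies the relation πH/k = ∫_{π/2}^{3π/2} (1+B·sin t)/√(1+B^2+2B·sin t) dt. Then for all s ∈ ℝ, y_{H,B}(s + 2π/H) = y_{H,B}(s) and x_{H,B}(s + 2π/H) = x_{H,B}(s) + 2π/k; that is, the undulary curve R(B,k) is 2π/k-periodic in the spatial variable x. -/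
open Real

/-- The axial velocity of the Kenmotsu curve of mean curvature `1`. -/
noncomputable def kenSpeed (B t : ℝ) : ℝ :=
  (1 + B * Real.sin t) / Real.sqrt (1 + B ^ 2 + 2 * B * Real.sin t)

theorem kenSpeed_periodic (B : ℝ) : Function.Periodic (kenSpeed B) (2 * Real.pi) := fun t => by
  simp only [kenSpeed, Real.sin_add_two_pi]

theorem kenSpeed_three_pi_sub (B t : ℝ) : kenSpeed B (3 * Real.pi - t) = kenSpeed B t := by
  have h : 3 * Real.pi - t = Real.pi - t + 2 * Real.pi := by ring
  rw [h, kenSpeed_periodic]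
  simp only [kenSpeed, Real.sin_pi_sub]

theorem continuous_kenSpeed {B : ℝ} (hB : B ∈ Set.Ioo (-1 : ℝ) 1) : Continuous (kenSpeed B) := by
  have hpos (t : ℝ) : 0 < 1 + B ^ 2 + 2 * B * Real.sin t := by
    have h : 0 < 1 + B * Real.sin t := by
      have hlt : |B * Real.sin t| < 1 := by
        rw [abs_mul]
        exact mul_lt_one_of_nonneg_of_lt_one_left (abs_nonneg B) (abs_lt.2 hB)
          (Real.abs_sin_le_one t)
      linarith [(abs_lt.1 hlt).1]
    nlinarith [pow_pos h 2, sq_nonneg (B * Real.cos t), Real.sin_sq_add_cos_sq t]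
  unfold kenSpeed
  exact Continuous.div (by fun_prop) (by fun_prop) fun t => (Real.sqrt_pos.2 (hpos t)).ne'

/-- The integral of the axial velocity over a full period is twice that over the half period
symmetric about `π`. -/
theorem integral_kenSpeed_period {B : ℝ} (hB : B ∈ Set.Ioo (-1 : ℝ) 1) (a : ℝ) :
    ∫ t in a..a + 2 * Real.pi, kenSpeed B t =
      2 * ∫ t in (Real.pi / 2)..(3 * Real.pi / 2), kenSpeed B t := by
  have hint (a b : ℝ) : IntervalIntegrable (kenSpeed B) MeasureTheory.volume a b :=
    (continuous_kenSpeed hB).intervalIntegrable a b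
  have hrefl := intervalIntegral.integral_comp_sub_left (a := Real.pi / 2)
    (b := 3 * Real.pi / 2) (kenSpeed B) (3 * Real.pi)
  simp only [kenSpeed_three_pi_sub] at hrefl
  rw [show 3 * Real.pi - 3 * Real.pi / 2 = 3 * Real.pi / 2 by ring,
    show 3 * Real.pi - Real.pi / 2 = Real.pi / 2 + 2 * Real.pi by ring] at hrefl
  rw [(kenSpeed_periodic B).intervalIntegral_add_eq a (Real.pi / 2),
    ← intervalIntegral.integral_add_adjacent_intervals (hint _ (3 * Real.pi / 2)) (hint _ _),
    ← hrefl, two_mul]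

theorem kenX_eq {H : ℝ} (hH : H ≠ 0) (B s : ℝ) :
    kenX H B s = H⁻¹ * ∫ t in (Real.pi / 2)..H * s, kenSpeed B t := by
  have h := intervalIntegral.integral_comp_mul_left (a := Real.pi / (2 * H)) (b := s)
    (kenSpeed B) hH
  rwa [show H * (Real.pi / (2 * H)) = Real.pi / 2 by field_simp] at h

/-- If `H` and `B` satisfy the period relation `πH/k = ∫_{π/2}^{3π/2} (1+B sin t)/√(1+B²+2B sin t) dt`,
then the undulary curve `R(B,k)` is `2π/k`-periodic in the spatial variable `x`. -/
theorem kenmotsu_periodic (k : ℕ) (hk : 1 ≤ k) (B H : ℝ)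
    (hB : B ∈ Set.Ioo (-1 : ℝ) 1) (hH : 0 < H)
    (hrel : Real.pi * H / k =
      ∫ t in (Real.pi / 2)..(3 * Real.pi / 2),
        (1 + B * Real.sin t) / Real.sqrt (1 + B ^ 2 + 2 * B * Real.sin t)) :
    ∀ s : ℝ,
      kenY H B (s + 2 * Real.pi / H) = kenY H B s ∧
      kenX H B (s + 2 * Real.pi / H) = kenX H B s + 2 * Real.pi / k := by
  intro s
  have hs : H * (s + 2 * Real.pi / H) = H * s + 2 * Real.pi := by field_simp
  refine ⟨by simp only [kenY, hs, Real.sin_add_two_pi], ?_⟩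
  have hint (a b : ℝ) : IntervalIntegrable (kenSpeed B) MeasureTheory.volume a b :=
    (continuous_kenSpeed hB).intervalIntegrable a b
  change _ = ∫ t in (Real.pi / 2)..(3 * Real.pi / 2), kenSpeed B t at hrel
  rw [kenX_eq hH.ne', kenX_eq hH.ne', hs,
    ← intervalIntegral.integral_add_adjacent_intervals (hint _ (H * s)) (hint _ _),
    integral_kenSpeed_period hB, ← hrel]
  field_simp
end

section
/- Let a > 0 and let h : ℝ → ℝ be smooth and 2π-periodic. For each fixed x ∈ ℝ, the function ε ↦ G(a + ε·h)(x) (defined for all ε in a neighborhood of 0 small enough that a + ε·h > 0) is differentiable at ε = 0, with derivative equal to −( h''(x)/a^2 + h''''(x) ). That is, the linearization of G at the constant function a is the operator h ↦ −∂_x^2( h/a^2 + ∂_x^2 h ). -/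
open Real

/-- The derivative of the mean curvature of the profile `a + ε h`. -/
lemma deriv_meanCurv_add_mul {a ε : ℝ} {h h₁ h₂ h₃ : ℝ → ℝ}
    (d₀ : ∀ y, HasDerivAt h (h₁ y) y) (d₁ : ∀ y, HasDerivAt h₁ (h₂ y) y)
    (d₂ : ∀ y, HasDerivAt h₂ (h₃ y) y) {y : ℝ} (hy : 0 < a + ε * h y) :
    deriv (meanCurv fun z => a + ε * h z) y =
      ε * √(1 + (ε * h₁ y) ^ 2) / (a + ε * h y) *
        (-(h₁ y / ((a + ε * h y) * (1 + (ε * h₁ y) ^ 2)))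
          - ε * h₁ y * h₂ y / (1 + (ε * h₁ y) ^ 2) ^ 2
          - (a + ε * h y) * h₃ y / (1 + (ε * h₁ y) ^ 2) ^ 2
          + 3 * ε ^ 2 * (a + ε * h y) * h₁ y * h₂ y ^ 2 / (1 + (ε * h₁ y) ^ 2) ^ 3) := by
  have e₁ : deriv (fun z => a + ε * h z) = fun z => ε * h₁ z :=
    funext fun z => (((d₀ z).const_mul ε).const_add a).deriv
  have e₂ : deriv (fun z => ε * h₁ z) = fun z => ε * h₂ z :=
    funext fun z => ((d₁ z).const_mul ε).deriv
  have hpow (z : ℝ) : (1 + (ε * h₁ z) ^ 2) ^ ((3 : ℝ) / 2) = √(1 + (ε * h₁ z) ^ 2) ^ 3 := by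
    rw [Real.sqrt_eq_rpow, ← Real.rpow_natCast (_ ^ _) 3, ← Real.rpow_mul (by positivity)]
    norm_num
  have eH : (meanCurv fun z => a + ε * h z) = fun z =>
      1 / ((a + ε * h z) * √(1 + (ε * h₁ z) ^ 2)) - ε * h₂ z / √(1 + (ε * h₁ z) ^ 2) ^ 3 := by
    funext z
    simp only [meanCurv, e₁, e₂, hpow]
  have hw : 0 < 1 + (ε * h₁ y) ^ 2 := by positivity
  have hs : 0 < √(1 + (ε * h₁ y) ^ 2) := Real.sqrt_pos.2 hw
  have dr := ((d₀ y).const_mul ε).const_add a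
  have ds := ((((d₁ y).const_mul ε).pow 2).const_add 1).sqrt hw.ne'
  have dH := ((hasDerivAt_const y (1 : ℝ)).div (dr.mul ds) (mul_pos hy hs).ne').sub
    (((d₂ y).const_mul ε).div (ds.pow 3) (pow_pos hs 3).ne')
  rw [eH]
  refine (HasDerivAt.deriv dH).trans ?_
  simp only [Pi.mul_apply, Pi.pow_apply]
  have hsq : 1 + (ε * h₁ y) ^ 2 = √(1 + (ε * h₁ y) ^ 2) ^ 2 := (Real.sq_sqrt hw.le).symm
  generalize √(1 + (ε * h₁ y) ^ 2) = s at *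
  rw [hsq]
  generalize a + ε * h y = r at *
  field_simp
  push_cast
  ring

/-- For the profile `a + ε h`, the operator `asdG` is `ε` times a function of `ε` that is
continuous at `0`, whose value there is the linearization. -/
lemma exists_continuousAt_asdG_add_mul {a : ℝ} (ha : 0 < a) {h h₁ h₂ h₃ h₄ : ℝ → ℝ}
    (d₀ : ∀ y, HasDerivAt h (h₁ y) y) (d₁ : ∀ y, HasDerivAt h₁ (h₂ y) y)
    (d₂ : ∀ y, HasDerivAt h₂ (h₃ y) y) (d₃ : ∀ y, HasDerivAt h₃ (h₄ y) y) (x : ℝ) :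
    ∃ M : ℝ → ℝ, ContinuousAt M 0 ∧ M 0 = -(h₂ x / a ^ 2 + h₄ x) ∧
      ∀ ε, 0 < a + ε * h x → asdG (fun y => a + ε * h y) x = ε * M ε := by
  have key (ε : ℝ) (hx : 0 < a + ε * h x) :
      asdG (fun y => a + ε * h y) x = ε * (1 / (a + ε * h x) * deriv (fun y =>
        -(h₁ y / ((a + ε * h y) * (1 + (ε * h₁ y) ^ 2)))
          - ε * h₁ y * h₂ y / (1 + (ε * h₁ y) ^ 2) ^ 2
          - (a + ε * h y) * h₃ y / (1 + (ε * h₁ y) ^ 2) ^ 2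
          + 3 * ε ^ 2 * (a + ε * h y) * h₁ y * h₂ y ^ 2 / (1 + (ε * h₁ y) ^ 2) ^ 3) x) := by
    have e₁ : deriv (fun z => a + ε * h z) = fun z => ε * h₁ z :=
      funext fun z => (((d₀ z).const_mul ε).const_add a).deriv
    have hc : ContinuousAt (fun y => a + ε * h y) x :=
      (((d₀ x).const_mul ε).const_add a).continuousAt
    rw [asdG, mul_left_comm]
    congr 1
    rw [← deriv_const_mul_field]
    apply Filter.EventuallyEq.deriv_eq
    filter_upwards [hc.eventually (lt_mem_nhds hx)] with y hy
    rw [deriv_meanCurv_add_mul d₀ d₁ d₂ hy, e₁]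
    have hs : 0 < √(1 + (ε * h₁ y) ^ 2) := Real.sqrt_pos.2 (by positivity)
    rw [← mul_assoc]
    congr 1
    field_simp
  have dP (ε : ℝ) (hx : 0 < a + ε * h x) := by
    have hw : 0 < 1 + (ε * h₁ x) ^ 2 := by positivity
    have dr := ((d₀ x).const_mul ε).const_add a
    have dw := (((d₁ x).const_mul ε).pow 2).const_add 1
    exact (((((d₁ x).div (dr.mul dw) (mul_pos hx hw).ne').neg.sub
      ((((d₁ x).const_mul ε).mul (d₂ x)).div (dw.pow 2) (pow_pos hw 2).ne')).sub
      ((dr.mul (d₃ x)).div (dw.pow 2) (pow_pos hw 2).ne')).add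
      ((((dr.const_mul (3 * ε ^ 2)).mul (d₁ x)).mul ((d₂ x).pow 2)).div (dw.pow 3)
        (pow_pos hw 3).ne')).deriv
  simp only [Pi.mul_apply, Pi.pow_apply] at dP
  refine ⟨_, ?_, ?_, fun ε hx => (key ε hx).trans
    (congrArg (fun t => ε * (1 / (a + ε * h x) * t)) (dP ε hx))⟩
  · fun_prop (disch := simp [ha.ne'])
  · simp
    field_simp
    ring

/-- The linearization of `G` at the constant function (cylinder of radius) `a` is the
operator `h ↦ -∂ₓ²(h/a² + ∂ₓ²h)`: for each `x`, the map `ε ↦ G(a + εh)(x)` is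
differentiable at `ε = 0` with derivative `-(h''(x)/a² + h''''(x))`. -/
theorem asdG_linearization_at_cylinder (a : ℝ) (ha : 0 < a) (h : ℝ → ℝ)
    (hh : ContDiff ℝ (⊤ : ℕ∞) h)
    (hper : ∀ x, h (x + 2 * Real.pi) = h x) :
    ∀ x : ℝ,
      HasDerivAt (fun ε : ℝ => asdG (fun y => a + ε * h y) x)
        (-(deriv (deriv h) x / a ^ 2 + deriv (deriv (deriv (deriv h))) x)) 0 := by
  intro x
  have c₁ := (contDiff_infty_iff_deriv.1 hh).2
  have c₂ := (contDiff_infty_iff_deriv.1 c₁).2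
  have c₃ := (contDiff_infty_iff_deriv.1 c₂).2
  have hd {f : ℝ → ℝ} (hf : ContDiff ℝ (⊤ : ℕ∞) f) (y : ℝ) : HasDerivAt f (deriv f y) y :=
    ((contDiff_infty_iff_deriv.1 hf).1 y).hasDerivAt
  obtain ⟨M, hM, hM0, hG⟩ := exists_continuousAt_asdG_add_mul ha (hd hh) (hd c₁) (hd c₂) (hd c₃) x
  have hpos : ∀ᶠ ε : ℝ in nhds 0, 0 < a + ε * h x := by
    have hc : ContinuousAt (fun ε : ℝ => a + ε * h x) 0 := by fun_prop
    exact hc.eventually (lt_mem_nhds (by simpa using ha))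
  have hprod : HasDerivAt (fun ε : ℝ => ε * M ε) (M 0) 0 := by
    rw [hasDerivAt_iff_tendsto_slope]
    refine (hM.tendsto.mono_left nhdsWithin_le_nhds).congr' ?_
    filter_upwards [self_mem_nhdsWithin] with ε hε
    have hε : ε ≠ 0 := hε
    simp [slope_def_field, hε]
  rw [← hM0]
  exact hprod.congr_of_eventuallyEq (hpos.mono fun ε hε => hG ε hε)
end

section
/- Let r : ℝ → ℝ be smooth, 2π-periodic (r(x+2π) = r(x) for all x), and positive (r(x) > 0 for all x), and suppose there is a constant c ∈ ℝ with H(r)(x) = c for all x ∈ ℝ. Then r is even about some point: there exists x₀ ∈ ℝ such that r(x₀ + x) = r(x₀ − x) for all x ∈ ℝ. (Up to translations along the axis of rotation, all equilibria of the axisymmetric surface diffusion flow are even.) -/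
open Real

/-- Two global solutions of an autonomous ODE whose vector field is `C¹` along one of them coincide
as soon as they agree at one time. -/
theorem eq_of_hasDerivAt_of_contDiffAt {E : Type*} [NormedAddCommGroup E] [NormedSpace ℝ E]
    {v : E → E} {f g : ℝ → E} (hv : ∀ t, ContDiffAt ℝ 1 v (f t))
    (hf : ∀ t, HasDerivAt f (v (f t)) t) (hg : ∀ t, HasDerivAt g (v (g t)) t)
    {t₀ : ℝ} (h₀ : f t₀ = g t₀) : f = g := by
  have hfc : Continuous f := continuous_iff_continuousAt.2 fun t => (hf t).continuousAt
  have hgc : Continuous g := continuous_iff_continuousAt.2 fun t => (hg t).continuousAt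
  have hopen : IsOpen {t | f t = g t} := by
    rw [isOpen_iff_mem_nhds]
    intro t (ht : f t = g t)
    obtain ⟨K, s, hs, hlip⟩ := (hv t).exists_lipschitzOnWith
    refine ODE_solution_unique_of_eventually (v := fun _ => v) (s := fun _ => s)
      (Filter.Eventually.of_forall fun _ => hlip) ?_ ?_ ht
    · filter_upwards [hfc.continuousAt.preimage_mem_nhds hs] with u hu using ⟨hf u, hu⟩
    · filter_upwards [hgc.continuousAt.preimage_mem_nhds (ht ▸ hs)] with u hu using ⟨hg u, hu⟩
  have huniv : {t | f t = g t} = Set.univ :=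
    IsClopen.eq_univ ⟨isClosed_eq hfc hgc, hopen⟩ ⟨t₀, h₀⟩
  funext t
  exact huniv.ge (Set.mem_univ t)

/-- A solution of `r'' = F(r, r')`, with `F` even in the second variable, is symmetric about each
of its critical points. -/
theorem reflection_symm_of_deriv_eq_zero {F : ℝ × ℝ → ℝ} {r : ℝ → ℝ} (hr : ContDiff ℝ 2 r)
    (hF : ∀ x, ContDiffAt ℝ 1 F (r x, deriv r x)) (heven : ∀ u p, F (u, -p) = F (u, p))
    (hode : ∀ x, deriv (deriv r) x = F (r x, deriv r x)) {x₀ : ℝ} (hx₀ : deriv r x₀ = 0) (x : ℝ) :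
    r (x₀ + x) = r (x₀ - x) := by
  have h₁ (y : ℝ) : HasDerivAt r (deriv r y) y :=
    (hr.differentiable (by norm_num) y).hasDerivAt
  have h₂ (y : ℝ) : HasDerivAt (deriv r) (F (r y, deriv r y)) y := by
    have hr' : ContDiff ℝ 1 (deriv r) := hr.deriv' (n := 1)
    exact hode y ▸ (hr'.differentiable (by norm_num) y).hasDerivAt
  have key := eq_of_hasDerivAt_of_contDiffAt (v := fun z : ℝ × ℝ => (z.2, F z))
    (f := fun t => (r (x₀ + t), deriv r (x₀ + t)))
    (g := fun t => (r (x₀ - t), -deriv r (x₀ - t))) (t₀ := 0)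
    (fun t => contDiffAt_snd.prodMk (hF (x₀ + t)))
    (fun t => ((h₁ (x₀ + t)).comp_const_add x₀ t).prodMk ((h₂ (x₀ + t)).comp_const_add x₀ t))
    (fun t => by
      have h := ((h₂ (x₀ - t)).comp_const_sub x₀ t).neg
      rw [neg_neg, ← heven] at h
      exact ((h₁ (x₀ - t)).comp_const_sub x₀ t).prodMk h)
    (by simp [hx₀])
  exact congrArg Prod.fst (congrFun key x)

/-- Up to translations along the axis of rotation, all equilibria of the axisymmetric
surface diffusion flow are even: a smooth positive `2π`-periodic profile of constant mean
curvature is symmetric about some point `x₀`. -/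
theorem cmc_profile_even_about_point (r : ℝ → ℝ)
    (hr : ContDiff ℝ (⊤ : ℕ∞) r)
    (hper : ∀ x, r (x + 2 * Real.pi) = r x)
    (hpos : ∀ x, 0 < r x)
    (c : ℝ) (hcmc : ∀ x : ℝ, meanCurv r x = c) :
    ∃ x₀ : ℝ, ∀ x : ℝ, r (x₀ + x) = r (x₀ - x) := by
  obtain ⟨x₀, -, hx₀⟩ := exists_deriv_eq_zero (f := r) Real.two_pi_pos hr.continuous.continuousOn
    (by simpa using (hper 0).symm)
  have hq (p : ℝ) : 0 < 1 + p ^ 2 := by positivity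
  refine ⟨x₀, reflection_symm_of_deriv_eq_zero
    (F := fun z => (1 + z.2 ^ 2) ^ ((3 : ℝ) / 2) * (1 / (z.1 * Real.sqrt (1 + z.2 ^ 2)) - c))
    (contDiff_infty.1 hr 2) (fun x => ?_) (fun u p => by simp) (fun x => ?_) hx₀⟩
  · have hq' := (hq (deriv r x)).ne'
    have hs : ContDiffAt ℝ 1 (fun z : ℝ × ℝ => 1 + z.2 ^ 2) (r x, deriv r x) := by fun_prop
    exact (hs.rpow_const_of_ne hq').mul
      ((contDiffAt_const.div (contDiffAt_fst.mul (hs.sqrt hq'))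
        (mul_ne_zero (hpos x).ne' (Real.sqrt_ne_zero'.2 (hq _)))).sub contDiffAt_const)
  · have hW := (Real.rpow_pos_of_pos (hq (deriv r x)) ((3 : ℝ) / 2)).ne'
    have h := hcmc x
    rw [meanCurv, sub_eq_iff_eq_add, ← sub_eq_iff_eq_add', eq_div_iff hW] at h
    rw [← h, mul_comm]
end

section
/- For every natural number ℓ ≥ 1 and every ε > 0, there exists a smooth function r : ℝ → ℝ that is positive, 2π/ℓ-periodic (r(x + 2π/ℓ) = r(x) for all x), nonconstant, has constant mean curvature (there exists c ∈ ℝ with H(r)(x) = c for all x), and satisfies sup_{x ∈ ℝ} |r(x) − 1/ℓ| < ε. (Nontrivial undulary equilibria of the axisymmetric surface diffusion flow bifurcate from the family of cylinders at every radius 1/ℓ.) -/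
open Real

open Filter in
/-- A smooth real function with derivative bounded below by a positive constant has a smooth
inverse. -/
theorem exists_contDiff_inverse_of_deriv_ge {X f : ℝ → ℝ} {m : ℝ} (hm : 0 < m)
    (hf : ContDiff ℝ (⊤ : ℕ∞) f) (hX : ∀ u, HasDerivAt X (f u) u) (hmf : ∀ u, m ≤ f u) :
    ∃ U : ℝ → ℝ, ContDiff ℝ (⊤ : ℕ∞) U ∧ (∀ x, X (U x) = x) ∧ (∀ u, U (X u) = u) ∧
      ∀ x, HasDerivAt U (f (U x))⁻¹ x := by
  have hpos : ∀ u, 0 < f u := fun u => hm.trans_le (hmf u)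
  have hderiv : deriv X = f := funext fun u => (hX u).deriv
  have hXd : Differentiable ℝ X := fun u => (hX u).differentiableAt
  have hXs : ContDiff ℝ (⊤ : ℕ∞) X :=
    contDiff_infty_iff_deriv.2 ⟨hXd, hderiv ▸ hf⟩
  have hmono : StrictMono X := strictMono_of_deriv_pos fun u => by
    rw [hderiv]; exact hpos u
  have hgd : ∀ u, HasDerivAt (fun u => X u - m * u) (f u - m) u := fun u =>
    ((hX u).sub ((hasDerivAt_id u).const_mul m)).congr_deriv (by simp)
  have hg : Monotone fun u => X u - m * u :=
    monotone_of_deriv_nonneg (fun u => (hgd u).differentiableAt) fun u => by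
      rw [(hgd u).deriv]; linarith [hmf u]
  have htop : Tendsto X atTop atTop := by
    refine tendsto_atTop_mono' atTop ?_
      (tendsto_atTop_add_const_right atTop (X 0) (tendsto_id.const_mul_atTop hm))
    filter_upwards [eventually_ge_atTop 0] with u hu
    have := hg hu
    simp only [id] at *
    linarith
  have hbot : Tendsto X atBot atBot := by
    refine tendsto_atBot_mono' atBot ?_
      (tendsto_atBot_add_const_right atBot (X 0) (tendsto_id.const_mul_atBot hm))
    filter_upwards [eventually_le_atBot 0] with u hu
    have := hg hu
    simp only [id] at *
    linarith
  let e : ℝ ≃ₜ ℝ :=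
    (hmono.orderIsoOfSurjective X (hXd.continuous.surjective htop hbot)).toHomeomorph
  have he : ∀ x, X (e.symm x) = x := e.apply_symm_apply
  refine ⟨e.symm, e.contDiff_symm_deriv (fun u => (hpos u).ne') hX hXs, he,
    e.symm_apply_apply, fun x => ?_⟩
  exact HasDerivAt.of_local_left_inverse e.symm.continuous.continuousAt (hX _) (hpos _).ne'
    (Eventually.of_forall he)

/-- The squared radius of the unduloid of eccentricity `B` is positive. -/
theorem unduloid_radicand_pos {B : ℝ} (hB₀ : 0 < B) (hB₁ : B < 1) (u : ℝ) :
    0 < 1 + B ^ 2 + 2 * B * sin u := by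
  nlinarith [neg_one_le_sin u, sq_pos_of_pos (sub_pos.2 hB₁)]

theorem unduloid_radius_mem_Icc {B : ℝ} (hB₀ : 0 < B) (hB₁ : B < 1) (u : ℝ) :
    √(1 + B ^ 2 + 2 * B * sin u) ∈ Set.Icc (1 - B) (1 + B) := by
  constructor
  · apply Real.le_sqrt_of_sq_le
    nlinarith [neg_one_le_sin u]
  · rw [Real.sqrt_le_left (by linarith)]
    nlinarith [sin_le_one u]

/-- A function traced along the unduloid of eccentricity `B` and scale `a`, whose parameter `U`
satisfies the unduloid equation, has constant mean curvature `1 / a`. -/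
theorem meanCurv_unduloid {a B : ℝ} (ha : 0 < a) (hB₀ : 0 < B) (hB₁ : B < 1) {U : ℝ → ℝ}
    (hU : ∀ x, HasDerivAt U
      (a * ((1 + B * sin (U x)) / √(1 + B ^ 2 + 2 * B * sin (U x))))⁻¹ x) (x : ℝ) :
    meanCurv (fun x => a * √(1 + B ^ 2 + 2 * B * sin (U x))) x = 1 / a := by
  have hp : ∀ u, 0 < 1 + B * sin u := fun u => by nlinarith [neg_one_le_sin u]
  have hq := unduloid_radicand_pos hB₀ hB₁
  have hd : deriv (fun x => a * √(1 + B ^ 2 + 2 * B * sin (U x))) =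
      fun x => B * cos (U x) / (1 + B * sin (U x)) := by
    funext y
    have h := ((((hU y).sin.const_mul (2 * B)).const_add (1 + B ^ 2)).sqrt
      (hq (U y)).ne').const_mul a
    rw [h.deriv]
    have hw := Real.sqrt_pos.2 (hq (U y))
    have hpy := hp (U y)
    field_simp
  have hdd : deriv (fun x => B * cos (U x) / (1 + B * sin (U x))) x =
      -(B * sin (U x) + B ^ 2) * √(1 + B ^ 2 + 2 * B * sin (U x)) /
        (a * (1 + B * sin (U x)) ^ 3) := by
    have h := ((hU x).cos.const_mul B).div (((hU x).sin.const_mul B).const_add 1) (hp (U x)).ne'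
    refine h.deriv.trans ?_
    have hw := Real.sqrt_pos.2 (hq (U x))
    have hpx := hp (U x)
    generalize √(1 + B ^ 2 + 2 * B * sin (U x)) = w at hw ⊢
    field_simp
    linear_combination (-B) * sin_sq_add_cos_sq (U x)
  have hw := Real.sqrt_pos.2 (hq (U x))
  have hw2 := Real.sq_sqrt (hq (U x)).le
  have hpx := hp (U x)
  unfold meanCurv
  rw [hd, hdd]
  simp only
  set w := √(1 + B ^ 2 + 2 * B * sin (U x))
  have h1 : 1 + (B * cos (U x) / (1 + B * sin (U x))) ^ 2 = (w / (1 + B * sin (U x))) ^ 2 := by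
    rw [div_pow, div_pow, hw2]
    field_simp
    linear_combination B ^ 2 * sin_sq_add_cos_sq (U x)
  have h2 : ((w / (1 + B * sin (U x))) ^ 2) ^ ((3 : ℝ) / 2) = (w / (1 + B * sin (U x))) ^ 3 := by
    rw [← Real.rpow_natCast _ 2, ← Real.rpow_mul (by positivity), ← Real.rpow_natCast _ 3]
    norm_num
  rw [h1, h2, Real.sqrt_sq (by positivity)]
  field_simp
  linear_combination -hw2

/-- Nontrivial undulary equilibria of the axisymmetric surface diffusion flow bifurcate
from the family of cylinders at every radius `1/ℓ`: arbitrarily close (uniformly) to the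
constant profile `1/ℓ` there are positive, `2π/ℓ`-periodic, nonconstant smooth profiles of
constant mean curvature. -/
theorem undulary_bifurcation_from_cylinders (ℓ : ℕ) (hℓ : 1 ≤ ℓ) (ε : ℝ) (hε : 0 < ε) :
    ∃ r : ℝ → ℝ,
      ContDiff ℝ (⊤ : ℕ∞) r ∧
      (∀ x : ℝ, 0 < r x) ∧
      (∀ x : ℝ, r (x + 2 * Real.pi / ℓ) = r x) ∧
      (∃ x y : ℝ, r x ≠ r y) ∧
      (∃ c : ℝ, ∀ x : ℝ, meanCurv r x = c) ∧
      ∀ x : ℝ, |r x - 1 / ℓ| < ε := by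
  have hℓ' : (0 : ℝ) < ℓ := by exact_mod_cast hℓ
  have hℓ₁ : (1 : ℝ) ≤ ℓ := by exact_mod_cast hℓ
  obtain ⟨B, hB₀, hB₂, hBε⟩ : ∃ B : ℝ, 0 < B ∧ B ≤ 1 / 2 ∧ 8 * B ≤ ε :=
    ⟨min (1 / 2) (ε / 8), by positivity, min_le_left _ _, by
      linarith [min_le_right (1 / 2) (ε / 8)]⟩
  have hB₁ : B < 1 := by linarith
  set w : ℝ → ℝ := fun u => √(1 + B ^ 2 + 2 * B * sin u) with hw_def
  set f : ℝ → ℝ := fun u => (1 + B * sin u) / w u with hf_def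
  have hwIcc : ∀ u, w u ∈ Set.Icc (1 - B) (1 + B) := unduloid_radius_mem_Icc hB₀ hB₁
  have hw_pos : ∀ u, 0 < w u := fun u => by linarith [(hwIcc u).1]
  have hw_smooth : ContDiff ℝ (⊤ : ℕ∞) w :=
    ContDiff.sqrt (by fun_prop) fun u => (unduloid_radicand_pos hB₀ hB₁ u).ne'
  have hf_smooth : ContDiff ℝ (⊤ : ℕ∞) f :=
    ContDiff.div (by fun_prop) hw_smooth fun u => (hw_pos u).ne'
  have hf_ge : ∀ u, (1 - B) / (1 + B) ≤ f u := fun u =>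
    div_le_div₀ (by nlinarith [neg_one_le_sin u]) (by nlinarith [neg_one_le_sin u])
      (hw_pos u) (hwIcc u).2
  have hf_le : ∀ u, f u ≤ (1 + B) / (1 - B) := fun u =>
    div_le_div₀ (by linarith) (by nlinarith [sin_le_one u]) (by linarith) (hwIcc u).1
  have hf_per : Function.Periodic f (2 * π) := fun u => by
    simp only [hf_def, hw_def, sin_add_two_pi]
  have hf_int : ∀ s t, IntervalIntegrable f MeasureTheory.volume s t :=
    fun s t => hf_smooth.continuous.intervalIntegrable s t
  have hX : ∀ u, HasDerivAt (fun u => ∫ t in (0 : ℝ)..u, f t) (f u) u := fun u =>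
    hf_smooth.continuous.integral_hasStrictDerivAt 0 u |>.hasDerivAt
  have hX_add : ∀ u, ∫ t in (0 : ℝ)..(u + 2 * π), f t =
      (∫ t in (0 : ℝ)..u, f t) + ∫ t in (0 : ℝ)..(2 * π), f t := fun u => by
    rw [← intervalIntegral.integral_add_adjacent_intervals (hf_int 0 u) (hf_int u (u + 2 * π)),
      hf_per.intervalIntegral_add_eq u 0, zero_add]
  have hm : 0 < (1 - B) / (1 + B) := div_pos (by linarith) (by linarith)
  obtain ⟨U, hU_smooth, hXU, hUX, hU⟩ :=
    exists_contDiff_inverse_of_deriv_ge hm hf_smooth hX hf_ge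
  have hI_ge : 2 * π * ((1 - B) / (1 + B)) ≤ ∫ t in (0 : ℝ)..(2 * π), f t := by
    have h := intervalIntegral.integral_mono_on two_pi_pos.le
      intervalIntegrable_const (hf_int 0 (2 * π)) fun t _ => hf_ge t
    rwa [intervalIntegral.integral_const, sub_zero, smul_eq_mul] at h
  have hI_le : ∫ t in (0 : ℝ)..(2 * π), f t ≤ 2 * π * ((1 + B) / (1 - B)) := by
    have h := intervalIntegral.integral_mono_on two_pi_pos.le
      (hf_int 0 (2 * π)) intervalIntegrable_const fun t _ => hf_le t
    rwa [intervalIntegral.integral_const, sub_zero, smul_eq_mul] at h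
  set X : ℝ → ℝ := fun u => ∫ t in (0 : ℝ)..u, f t
  replace hUX : ∀ u, U (X u) = u := hUX
  set I : ℝ := ∫ t in (0 : ℝ)..(2 * π), f t
  have hI_pos : 0 < I := lt_of_lt_of_le (by positivity) hI_ge
  have hU_add : ∀ x, U (x + I) = U x + 2 * π := fun x => by
    rw [← hUX (U x + 2 * π)]
    congr 1
    exact ((hX_add (U x)).trans (congrArg (· + I) (hXU x))).symm
  set a : ℝ := 2 * π / (ℓ * I) with ha_def
  have ha : 0 < a := by positivity
  have haI : a * I = 2 * π / ℓ := by rw [ha_def]; field_simp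
  have ha_le : ℓ * a ≤ (1 + B) / (1 - B) := by
    have : ℓ * a = 2 * π / I := by rw [ha_def]; field_simp
    rw [this, div_le_iff₀ hI_pos]
    calc 2 * π = (1 + B) / (1 - B) * (2 * π * ((1 - B) / (1 + B))) := by
          have : 0 < 1 - B := by linarith
          field_simp
      _ ≤ _ := mul_le_mul_of_nonneg_left hI_ge (div_pos (by linarith) (by linarith)).le
  have ha_ge : (1 - B) / (1 + B) ≤ ℓ * a := by
    have : ℓ * a = 2 * π / I := by rw [ha_def]; field_simp
    rw [this, le_div_iff₀ hI_pos]
    calc _ ≤ (1 - B) / (1 + B) * (2 * π * ((1 + B) / (1 - B))) :=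
          mul_le_mul_of_nonneg_left hI_le hm.le
      _ = 2 * π := by
          have : 0 < 1 - B := by linarith
          field_simp
  refine ⟨fun x => a * w (U (x / a)), ?_, fun x => mul_pos ha (hw_pos _), fun x => ?_,
    ⟨a * X (π / 2), a * X (-(π / 2)), ?_⟩, ⟨1 / a, fun x => ?_⟩, fun x => ?_⟩
  · exact contDiff_const.mul (hw_smooth.comp (hU_smooth.comp (contDiff_id.div_const a)))
  · have : (x + 2 * π / ℓ) / a = x / a + I := by rw [← haI]; field_simp
    simp only [this, hU_add, hw_def, sin_add_two_pi]
  · simp only [mul_div_cancel_left₀ _ ha.ne', hUX]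
    intro h
    have h' := (Real.sqrt_inj (unduloid_radicand_pos hB₀ hB₁ _).le
      (unduloid_radicand_pos hB₀ hB₁ _).le).1 (mul_left_cancel₀ ha.ne' h)
    rw [sin_neg, sin_pi_div_two] at h'
    linarith
  · refine meanCurv_unduloid (U := fun x => U (x / a)) ha hB₀ hB₁ (fun y => ?_) x
    have h := (hU (y / a)).comp y ((hasDerivAt_id y).div_const a)
    refine h.congr_deriv ?_
    rw [mul_inv, one_div, mul_comm]
  · obtain ⟨h₁, h₂⟩ := hwIcc (U (x / a))
    have hup : ℓ * a * w (U (x / a)) ≤ 1 + 7 * B :=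
      calc ℓ * a * w (U (x / a)) ≤ (1 + B) / (1 - B) * (1 + B) :=
            mul_le_mul ha_le h₂ (hw_pos _).le (div_pos (by linarith) (by linarith)).le
        _ ≤ 1 + 7 * B := by
            rw [div_mul_eq_mul_div, div_le_iff₀ (by linarith)]
            nlinarith
    have hlo : 1 - 7 * B ≤ ℓ * a * w (U (x / a)) :=
      calc 1 - 7 * B ≤ (1 - B) / (1 + B) * (1 - B) := by
            rw [div_mul_eq_mul_div, le_div_iff₀ (by linarith)]
            nlinarith
        _ ≤ ℓ * a * w (U (x / a)) :=
            mul_le_mul ha_ge h₁ (by linarith) (by positivity)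
    have hdiff : a * w (U (x / a)) - 1 / ℓ = (ℓ * a * w (U (x / a)) - 1) / ℓ := by
      field_simp
    simp only [hdiff]
    rw [abs_div, abs_of_pos hℓ', div_lt_iff₀ hℓ']
    have : |ℓ * a * w (U (x / a)) - 1| ≤ 7 * B := abs_le.2 ⟨by linarith, by linarith⟩
    nlinarith
end
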